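/- There exists a binary self-dual code C ⊆ (ZMod 2)^{56} of dimension 28 whose minimum nonzero Hamming weight is 10, such that the number of codewords of Hamming weight 10 is 260 and the number of codewords of Hamming weight 12 is 4342 (i.e. C has weight enumerator W_{56,1} with α = −12). -/

import Mathlib

/-- The dual of a linear code `C ⊆ Rⁿ` with respect to the form `∑ᵢ vᵢ wᵢ`. -/
def dualCode {R : Type*} [CommRing R] {ι : Type*} [Fintype ι]
    (C : Submodule R (ι → R)) : Submodule R (ι → R) where
  carrier := {w | ∀ v ∈ C, ∑ i, v i * w i = 0}
  zero_mem' := by intro v _; simp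
  add_mem' := by
    intro a b ha hb v hv
    have h1 := ha v hv
    have h2 := hb v hv
    simp only [Pi.add_apply, mul_add, Finset.sum_add_distrib, h1, h2, add_zero]
  smul_mem' := by
    intro c w hw v hv
    have h := hw v hv
    have : ∑ i, v i * (c • w) i = c * ∑ i, v i * w i := by
      rw [Finset.mul_sum]
      exact Finset.sum_congr rfl fun i _ => by
        simp [smul_eq_mul, mul_left_comm]
    simp only [Set.mem_setOf_eq] at *
    simpa [h] using this

/-- The number whose base `2 ^ 32` expansion consists of `n` ones. -/
def lanesOne (n : ℕ) : ℕ := (1 <<< (32 * n) - 1) / (2 ^ 32 - 1)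

/-- Lists of numbers below `2 ^ 32` are packed as a pair of their length and the number with these
base `2 ^ 32` digits. This appends to `t` the list `p` with `r` added to every entry. -/
def appendXor (r : ℕ) (t p : ℕ × ℕ) : ℕ × ℕ :=
  (t.1 + p.1, t.2 + (p.2 ^^^ (r * lanesOne p.1)) <<< (32 * t.1))

/-- The packed lists of all sums of `k` members of a list, for `k < K`. -/
def packedWords (K : ℕ) : List ℕ → List (ℕ × ℕ)
  | [] => (List.range K).map fun k => if k = 0 then (1, 0) else (0, 0)
  | r :: rs => List.zipWith (appendXor r) (packedWords K rs) ((0, 0) :: packedWords K rs)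

/-- The `j`-th bit of each of the lowest `n` digits of `v` in base `2 ^ 32`. -/
def lanesBit (n v j : ℕ) : ℕ := (v >>> j) &&& lanesOne n

/-- The digitwise number of ones among the lowest 28 bits. -/
def lanesWeight (n v : ℕ) : ℕ := ((List.range 28).map (lanesBit n v)).sum

/-- The number of the `n` digits of `W` that are at least `t`. -/
def countGe (n W t : ℕ) : ℕ :=
  lanesBit n (W + (32 - t) * lanesOne n) 5 % (2 ^ 32 - 1)

/-- The number of members of weight `t` of a packed list. -/
def countEq (p : ℕ × ℕ) (t : ℕ) : ℕ :=
  countGe p.1 (lanesWeight p.1 p.2) t - countGe p.1 (lanesWeight p.1 p.2) (t + 1)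

/-- The number of words of weight `w` in a code with generator matrices `[I | A]` and `[Aᵀ | I]`,
from the packed sums `a` of rows of `A` and `b` of rows of `Aᵀ`. -/
def weightCount (a b : List (ℕ × ℕ)) (w : ℕ) : ℕ :=
  ((List.range (w + 1)).map fun k =>
    if 2 * k ≤ w then countEq (a.getD k (0, 0)) (w - k)
    else countEq (b.getD (w - k) (0, 0)) k).sum

theorem xor_add_two_pow_mul {b x y : ℕ} (hx : x < 2 ^ b) (hy : y < 2 ^ b) (p q : ℕ) :
    (x + 2 ^ b * p) ^^^ (y + 2 ^ b * q) = (x ^^^ y) + 2 ^ b * (p ^^^ q) := by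
  apply Nat.eq_of_testBit_eq
  intro i
  rw [Nat.testBit_xor, add_comm x, add_comm y, add_comm (x ^^^ y),
    Nat.testBit_two_pow_mul_add _ hx, Nat.testBit_two_pow_mul_add _ hy,
    Nat.testBit_two_pow_mul_add _ (Nat.xor_lt_two_pow hx hy)]
  split_ifs <;> simp

theorem shiftRight_and_add_two_pow_mul {b j x : ℕ} (hx : x < 2 ^ b) (hj : j < b) (p q : ℕ) :
    ((x + 2 ^ b * p) >>> j) &&& (1 + 2 ^ b * q) =
      (x.testBit j).toNat + 2 ^ b * ((p >>> j) &&& q) := by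
  have hb : 1 < 2 ^ b := Nat.one_lt_two_pow (by omega)
  apply Nat.eq_of_testBit_eq
  intro i
  rw [Nat.testBit_and, Nat.testBit_shiftRight, add_comm x, add_comm 1, add_comm (x.testBit j).toNat,
    Nat.testBit_two_pow_mul_add _ hx, Nat.testBit_two_pow_mul_add _ hb,
    Nat.testBit_two_pow_mul_add _ ((Bool.toNat_le _).trans_lt hb)]
  by_cases hi : i < b
  · rcases Nat.eq_zero_or_pos i with rfl | h
    · cases h : x.testBit j <;> simp [hj, hi]
    · have h1 : Nat.testBit 1 i = false := by
        exact Nat.testBit_lt_two_pow (Nat.one_lt_two_pow h.ne')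
      cases h2 : x.testBit j <;> simp [hi, h1]
  · have h1 : ¬ (j + i < b) := by omega
    have h2 : j + i - b = j + (i - b) := by omega
    simp [hi, h1, h2]

theorem lanesOne_eq (n : ℕ) : lanesOne n = Nat.ofDigits (2 ^ 32) (List.replicate n 1) := by
  have h : ∀ n, Nat.ofDigits (2 ^ 32) (List.replicate n 1) =
      ∑ i ∈ Finset.range n, (2 ^ 32) ^ i := by
    intro n
    induction n with
    | zero => simp
    | succ n ih =>
      rw [List.replicate_succ, Nat.ofDigits_cons, ih, Finset.sum_range_succ', Finset.mul_sum]
      simp [pow_succ', add_comm]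
  rw [h, Nat.geomSum_eq (by norm_num), lanesOne, Nat.one_shiftLeft, pow_mul]

theorem lanesOne_succ (n : ℕ) : lanesOne (n + 1) = 1 + 2 ^ 32 * lanesOne n := by
  simp [lanesOne_eq, List.replicate_succ, Nat.ofDigits_cons]

theorem lanesBit_ofDigits {l : List ℕ} (hl : ∀ x ∈ l, x < 2 ^ 32) {j : ℕ} (hj : j < 32) :
    lanesBit l.length (Nat.ofDigits (2 ^ 32) l) j =
      Nat.ofDigits (2 ^ 32) (l.map fun x => (x.testBit j).toNat) := by
  induction l with
  | nil => simp [lanesBit]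
  | cons x l ih =>
    simp only [List.forall_mem_cons] at hl
    simp only [lanesBit, List.length_cons, lanesOne_succ, List.map_cons, Nat.ofDigits_cons] at ih ⊢
    rw [shiftRight_and_add_two_pow_mul hl.1 hj, ih hl.2]

theorem ofDigits_map_xor {r : ℕ} (hr : r < 2 ^ 32) {l : List ℕ} (hl : ∀ x ∈ l, x < 2 ^ 32) :
    Nat.ofDigits (2 ^ 32) l ^^^ (r * lanesOne l.length) =
      Nat.ofDigits (2 ^ 32) (l.map (r ^^^ ·)) := by
  induction l with
  | nil => simp [lanesOne]
  | cons x l ih =>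
    simp only [List.forall_mem_cons] at hl
    simp only [List.length_cons, lanesOne_succ, List.map_cons, Nat.ofDigits_cons]
    rw [mul_add, mul_one, mul_left_comm, xor_add_two_pow_mul hl.1 hr, ih hl.2, Nat.xor_comm]

/-- The sums of all `k`-element subfamilies of `rs`, words being encoded by their binary digits. -/
def subsetSums : List ℕ → ℕ → List ℕ
  | _, 0 => [0]
  | [], _ + 1 => []
  | r :: rs, k + 1 => subsetSums rs (k + 1) ++ (subsetSums rs k).map (r ^^^ ·)

theorem subsetSums_lt {m : ℕ} {rs : List ℕ} (h : ∀ r ∈ rs, r < 2 ^ m) (k : ℕ) :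
    ∀ x ∈ subsetSums rs k, x < 2 ^ m := by
  induction rs generalizing k with
  | nil => cases k <;> simp [subsetSums]
  | cons r rs ih =>
    simp only [List.forall_mem_cons] at h
    cases k with
    | zero => simp [subsetSums]
    | succ k =>
      simp only [subsetSums, List.mem_append, List.mem_map]
      rintro x (hx | ⟨y, hy, rfl⟩)
      · exact ih h.2 _ x hx
      · exact Nat.xor_lt_two_pow h.1 (ih h.2 _ y hy)

theorem packedWords_eq (K : ℕ) {rs : List ℕ} (h : ∀ r ∈ rs, r < 2 ^ 32) :
    packedWords K rs = (List.range K).map fun k =>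
      ((subsetSums rs k).length, Nat.ofDigits (2 ^ 32) (subsetSums rs k)) := by
  induction rs with
  | nil =>
    refine List.map_congr_left fun k _ => ?_
    cases k <;> simp [subsetSums]
  | cons r rs ih =>
    simp only [List.forall_mem_cons] at h
    rw [packedWords, ih h.2]
    refine List.ext_getElem (by simp) fun k h1 h2 => ?_
    rcases k with _ | k
    · simp [appendXor, subsetSums, lanesOne]
    · simp only [List.getElem_zipWith, List.getElem_map, List.getElem_range, List.getElem_cons_succ,
        appendXor, subsetSums, List.length_append, List.length_map, Nat.ofDigits_append,
        ← ofDigits_map_xor h.1 (subsetSums_lt h.2 k), Nat.shiftLeft_eq, pow_mul]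
      rw [mul_comm (_ ^^^ _)]

/-- The number of ones among the lowest 28 binary digits. -/
def bitWeight (x : ℕ) : ℕ := ((List.range 28).map fun j => (x.testBit j).toNat).sum

theorem bitWeight_le (x : ℕ) : bitWeight x ≤ 28 := by
  simpa [bitWeight] using List.sum_le_card_nsmul
    ((List.range 28).map fun j => (x.testBit j).toNat) 1 (by simp [Bool.toNat_le])

theorem ofDigits_map_sum (b : ℕ) (l : List ℕ) (js : List ℕ) (f : ℕ → ℕ → ℕ) :
    (js.map fun j => Nat.ofDigits b (l.map (f j))).sum =
      Nat.ofDigits b (l.map fun x => (js.map fun j => f j x).sum) := by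
  induction l with
  | nil => simp
  | cons x l ih => simp [Nat.ofDigits_cons, List.sum_map_add, List.sum_map_mul_left, ih]

theorem lanesWeight_ofDigits {l : List ℕ} (hl : ∀ x ∈ l, x < 2 ^ 32) :
    lanesWeight l.length (Nat.ofDigits (2 ^ 32) l) =
      Nat.ofDigits (2 ^ 32) (l.map bitWeight) := by
  have h : lanesWeight l.length (Nat.ofDigits (2 ^ 32) l) =
      ((List.range 28).map fun j =>
        Nat.ofDigits (2 ^ 32) (l.map fun x => (x.testBit j).toNat)).sum := by
    refine congrArg List.sum (List.map_congr_left fun j hj => ?_)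
    exact lanesBit_ofDigits hl (by have := List.mem_range.1 hj; omega)
  rw [h, ofDigits_map_sum]
  rfl

theorem ofDigits_add_mul_lanesOne (c : ℕ) (l : List ℕ) :
    Nat.ofDigits (2 ^ 32) l + c * lanesOne l.length = Nat.ofDigits (2 ^ 32) (l.map (· + c)) := by
  induction l with
  | nil => simp [lanesOne]
  | cons x l ih =>
    rw [List.length_cons, lanesOne_succ, List.map_cons, Nat.ofDigits_cons, Nat.ofDigits_cons, ← ih]
    push_cast
    ring

theorem countGe_ofDigits {l : List ℕ} (hl : ∀ x ∈ l, x < 32) {t : ℕ} (ht : t ≤ 32)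
    (hlen : l.length < 2 ^ 32 - 1) :
    countGe l.length (Nat.ofDigits (2 ^ 32) l) t = l.countP (t ≤ ·) := by
  have key : (l.map fun x => ((x + (32 - t)).testBit 5).toNat).sum = l.countP (t ≤ ·) := by
    clear hlen
    induction l with
    | nil => simp
    | cons x l ih =>
      simp only [List.forall_mem_cons] at hl
      have hx : (x + (32 - t)).testBit 5 = decide (t ≤ x) := by
        rw [Nat.testBit_eq_decide_div_mod_eq]
        exact decide_eq_decide.2 (by omega)
      rw [List.map_cons, List.sum_cons, ih hl.2, List.countP_cons, hx, add_comm]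
      by_cases h : t ≤ x <;> simp [h]
  have hlt : ∀ x ∈ l.map (· + (32 - t)), x < 2 ^ 32 := by
    simp only [List.mem_map]
    rintro _ ⟨x, hx, rfl⟩
    have := hl x hx
    omega
  have := lanesBit_ofDigits hlt (j := 5) (by norm_num)
  rw [List.length_map] at this
  rw [countGe, ofDigits_add_mul_lanesOne, this, List.map_map,
    Nat.ofDigits_modEq' (2 ^ 32) 1 (2 ^ 32 - 1) (by decide), Nat.ofDigits_one]
  exact (Nat.mod_eq_of_lt (by
    erw [key]; exact List.countP_le_length.trans_lt hlen)).trans key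

theorem countEq_ofDigits {l : List ℕ} (hl : ∀ x ∈ l, x < 2 ^ 32) {t : ℕ} (ht : t < 32)
    (hlen : l.length < 2 ^ 32 - 1) :
    countEq (l.length, Nat.ofDigits (2 ^ 32) l) t = l.countP (bitWeight · = t) := by
  have hw : ∀ x ∈ l.map bitWeight, x < 32 := by
    simp only [List.mem_map]
    rintro _ ⟨x, _, rfl⟩
    have := bitWeight_le x
    omega
  have h := fun s (hs : s ≤ 32) => countGe_ofDigits hw hs (by rwa [List.length_map])
  simp only [List.length_map] at h
  rw [countEq, lanesWeight_ofDigits hl, h _ ht.le, h _ ht]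
  clear h hw hlen hl
  simp only [List.countP_map]
  rw [Nat.sub_eq_iff_eq_add (List.countP_mono_left (by simp; omega))]
  induction l with
  | nil => simp
  | cons x l ih =>
    simp only [List.countP_cons, ih, Function.comp_apply, decide_eq_true_eq]
    split_ifs <;> omega

theorem length_subsetSums (rs : List ℕ) (k : ℕ) :
    (subsetSums rs k).length = rs.length.choose k := by
  induction rs generalizing k with
  | nil => cases k <;> simp [subsetSums]
  | cons r rs ih => cases k <;> simp [subsetSums, ih, Nat.choose_succ_succ, add_comm]

open Matrix

/-- The code with generator matrix `[I | A]`. -/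
def systematicCode {R : Type*} [CommRing R] {n m : ℕ} (A : Matrix (Fin n) (Fin m) R) :
    Submodule R (Fin (n + m) → R) where
  carrier := Set.range fun x : Fin n → R => Fin.append x (x ᵥ* A)
  zero_mem' := ⟨0, by ext i; refine Fin.addCases (fun i => ?_) (fun i => ?_) i <;> simp⟩
  add_mem' := by
    rintro _ _ ⟨x, rfl⟩ ⟨y, rfl⟩
    refine ⟨x + y, ?_⟩
    ext i
    refine Fin.addCases (fun i => ?_) (fun i => ?_) i <;> simp [Matrix.add_vecMul]
  smul_mem' := by
    rintro c _ ⟨x, rfl⟩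
    refine ⟨c • x, ?_⟩
    ext i
    refine Fin.addCases (fun i => ?_) (fun i => ?_) i <;> simp [Matrix.smul_vecMul]

theorem dualCode_systematicCode {R : Type*} [CommRing R] [CharP R 2] {n : ℕ}
    {A : Matrix (Fin n) (Fin n) R} (hA : A * Aᵀ = 1) :
    systematicCode A = dualCode (systematicCode A) := by
  have hA' : Aᵀ * A = 1 := mul_eq_one_comm.1 hA
  have hself : ∀ a : Fin n → R, a + a = 0 := fun a => funext fun i => CharTwo.add_self_eq_zero (a i)
  have hsum : ∀ x a b : Fin n → R,
      ∑ i, Fin.append x (x ᵥ* A) i * Fin.append a b i = x ⬝ᵥ (a + A *ᵥ b) := by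
    intro x a b
    rw [Fin.sum_univ_add, dotProduct_add, Matrix.dotProduct_mulVec]
    simp only [dotProduct, Fin.append_left, Fin.append_right]
  ext w
  constructor
  · rintro ⟨y, rfl⟩ _ ⟨x, rfl⟩
    rw [hsum, ← Matrix.mulVec_transpose, Matrix.mulVec_mulVec, hA, Matrix.one_mulVec,
      hself, dotProduct_zero]
  · intro hw
    obtain ⟨a, b, rfl⟩ : ∃ a b, w = Fin.append a b :=
      ⟨_, _, (Fin.append_castAdd_natAdd).symm⟩
    have h0 : a + A *ᵥ b = 0 :=
      dotProduct_eq_zero _ fun x => by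
        rw [dotProduct_comm, ← hsum]
        exact hw _ ⟨x, rfl⟩
    refine ⟨a, congrArg (Fin.append a) ?_⟩
    rw [add_right_cancel (h0.trans (hself (A *ᵥ b)).symm), ← Matrix.mulVec_transpose,
      Matrix.mulVec_mulVec, hA', Matrix.one_mulVec]

theorem append_vecMul_injective {R : Type*} [CommRing R] {n m : ℕ} (A : Matrix (Fin n) (Fin m) R) :
    Function.Injective fun x : Fin n → R => Fin.append x (x ᵥ* A) := by
  intro x y h
  ext i
  simpa using congrFun h (Fin.castAdd m i)

theorem finrank_systematicCode {K : Type*} [Field K] {n m : ℕ} (A : Matrix (Fin n) (Fin m) K) :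
    Module.finrank K (systematicCode A) = n := by
  let f : (Fin n → K) →ₗ[K] systematicCode A :=
    { toFun := fun x => ⟨_, x, rfl⟩
      map_add' := fun x y => by
        ext i
        refine Fin.addCases (fun i => ?_) (fun i => ?_) i <;> simp [Matrix.add_vecMul]
      map_smul' := fun c x => by
        ext i
        refine Fin.addCases (fun i => ?_) (fun i => ?_) i <;> simp [Matrix.smul_vecMul] }
  have hf : Function.Bijective f :=
    ⟨fun x y h => append_vecMul_injective A (congrArg Subtype.val h),
      fun ⟨_, x, hx⟩ => ⟨x, Subtype.ext hx⟩⟩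
  rw [← (LinearEquiv.ofBijective f hf).finrank_eq, Module.finrank_fin_fun]

theorem hammingNorm_append {R : Type*} [DecidableEq R] [Zero R] {n m : ℕ} (x : Fin n → R)
    (y : Fin m → R) : hammingNorm (Fin.append x y) = hammingNorm x + hammingNorm y := by
  simp only [hammingNorm, Finset.card_filter, Fin.sum_univ_add, Fin.append_left, Fin.append_right]

/-- The number of messages of weight `k` whose check word with respect to `A` has weight `t`. -/
noncomputable def splitCount {n m : ℕ} (A : Matrix (Fin n) (Fin m) (ZMod 2)) (k t : ℕ) : ℕ :=
  Nat.card {x : Fin n → ZMod 2 // hammingNorm x = k ∧ hammingNorm (x ᵥ* A) = t}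

theorem splitCount_transpose {n : ℕ} {A : Matrix (Fin n) (Fin n) (ZMod 2)} (hA : A * Aᵀ = 1)
    (k t : ℕ) : splitCount Aᵀ t k = splitCount A k t := by
  have hA' : Aᵀ * A = 1 := mul_eq_one_comm.1 hA
  refine Nat.card_congr
    { toFun := fun x => ⟨x.1 ᵥ* Aᵀ, x.2.2, ?_⟩
      invFun := fun x => ⟨x.1 ᵥ* A, x.2.2, ?_⟩
      left_inv := fun x => ?_
      right_inv := fun x => ?_ }
  · rw [Matrix.vecMul_vecMul, hA', Matrix.vecMul_one, x.2.1]
  · rw [Matrix.vecMul_vecMul, hA, Matrix.vecMul_one, x.2.1]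
  · simp [Matrix.vecMul_vecMul, hA']
  · simp [Matrix.vecMul_vecMul, hA]

theorem ncard_systematicCode {n m : ℕ} (A : Matrix (Fin n) (Fin m) (ZMod 2)) (w : ℕ) :
    {v : Fin (n + m) → ZMod 2 | v ∈ systematicCode A ∧ hammingNorm v = w}.ncard =
      ∑ k ∈ Finset.range (w + 1), splitCount A k (w - k) := by
  classical
  have h : {v : Fin (n + m) → ZMod 2 | v ∈ systematicCode A ∧ hammingNorm v = w} =
      (fun x : Fin n → ZMod 2 => Fin.append x (x ᵥ* A)) ''
        {x | hammingNorm x + hammingNorm (x ᵥ* A) = w} := by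
    ext v
    constructor
    · rintro ⟨⟨x, rfl⟩, hx⟩
      exact ⟨x, by rwa [hammingNorm_append] at hx, rfl⟩
    · rintro ⟨x, hx, rfl⟩
      exact ⟨⟨x, rfl⟩, by rwa [hammingNorm_append]⟩
  rw [h, Set.ncard_image_of_injective _ (append_vecMul_injective A), Set.ncard_eq_toFinset_card',
    Finset.card_eq_sum_card_fiberwise (f := hammingNorm) (t := Finset.range (w + 1))]
  · refine Finset.sum_congr rfl fun k hk => ?_
    rw [splitCount, Nat.card_eq_fintype_card, Fintype.card_subtype]
    congr 1
    ext x
    simp only [Finset.mem_range] at hk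
    simp
    omega
  · intro x hx
    simp at hx ⊢
    omega

/-- The word in `(ZMod 2) ^ m` with the binary digits of `a`. -/
def bitVec (m a : ℕ) : Fin m → ZMod 2 := fun j => if a.testBit j then 1 else 0

theorem bitVec_xor (m a b : ℕ) : bitVec m (a ^^^ b) = bitVec m a + bitVec m b := by
  ext j
  cases h : a.testBit j <;> cases h' : b.testBit j <;>
    simp [bitVec, h, h', CharTwo.add_self_eq_zero]

theorem hammingNorm_bitVec (a : ℕ) : hammingNorm (bitVec 28 a) = bitWeight a := by
  rw [bitWeight, ← List.map_coe_finRange_eq_range, List.map_map, ← List.ofFn_eq_map, List.sum_ofFn,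
    hammingNorm, Finset.card_filter]
  refine Finset.sum_congr rfl fun j _ => ?_
  cases h : a.testBit j <;> simp [bitVec, h]

theorem hammingNorm_cons {n : ℕ} (c : ZMod 2) (x : Fin n → ZMod 2) :
    hammingNorm (Fin.cons c x : Fin (n + 1) → ZMod 2) =
      (if c = 0 then 0 else 1) + hammingNorm x := by
  simp only [hammingNorm, Finset.card_filter, Fin.sum_univ_succ, Fin.cons_zero, Fin.cons_succ]
  split_ifs <;> simp_all

theorem finCons_vecMul {R : Type*} [CommRing R] {n m : ℕ} (c : R) (x : Fin n → R)
    (A : Matrix (Fin (n + 1)) (Fin m) R) :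
    (Fin.cons c x : Fin (n + 1) → R) ᵥ* A = c • A 0 + x ᵥ* Matrix.of fun i => A i.succ := by
  simp only [Matrix.vecMul_eq_sum, Fin.sum_univ_succ, Fin.cons_zero, Fin.cons_succ]
  rfl

/-- The matrix over `ZMod 2` with rows encoded by binary digits. -/
def bitMatrix (m : ℕ) (rs : List ℕ) : Matrix (Fin rs.length) (Fin m) (ZMod 2) :=
  Matrix.of fun i => bitVec m rs[i]

theorem card_weight_eq_countP (m : ℕ) (rs : List ℕ) (k : ℕ) (P : (Fin m → ZMod 2) → Prop)
    [DecidablePred P] :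
    Nat.card {x : Fin rs.length → ZMod 2 // hammingNorm x = k ∧ P (x ᵥ* bitMatrix m rs)} =
      (subsetSums rs k).countP fun a => P (bitVec m a) := by
  induction rs generalizing k P with
  | nil =>
    have hb : bitVec m 0 = 0 := by ext; simp [bitVec]
    have h : ∀ x : Fin ([] : List ℕ).length → ZMod 2, hammingNorm x = 0 ∧ x ᵥ* bitMatrix m [] = 0 :=
      fun x => ⟨by simp [hammingNorm], by ext; simp [Matrix.vecMul, dotProduct]⟩
    simp only [(h _).1, (h _).2]
    rw [Nat.card_eq_fintype_card, Fintype.card_subtype]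
    cases k with
    | zero => by_cases hP : P 0 <;> simp [subsetSums, hb, hP]
    | succ k => simp [subsetSums]
  | cons r rs ih =>
    have hx : ∀ (c : ZMod 2) (x : Fin rs.length → ZMod 2),
        (Fin.cons c x : Fin (rs.length + 1) → ZMod 2) ᵥ* bitMatrix m (r :: rs) =
          c • bitVec m r + x ᵥ* bitMatrix m rs := fun c x => finCons_vecMul c x _
    have hsum : Nat.card {x : Fin (rs.length + 1) → ZMod 2 //
          hammingNorm x = k ∧ P (x ᵥ* bitMatrix m (r :: rs))} =
        Nat.card {x : Fin rs.length → ZMod 2 //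
          hammingNorm x = k ∧ P (x ᵥ* bitMatrix m rs)} +
        Nat.card {x : Fin rs.length → ZMod 2 //
          hammingNorm x + 1 = k ∧ P (bitVec m r + x ᵥ* bitMatrix m rs)} := by
      simp only [Nat.card_eq_fintype_card, Fintype.card_subtype, Finset.card_filter]
      rw [← (Fin.consEquiv fun _ : Fin (rs.length + 1) => ZMod 2).sum_comp,
        Fintype.sum_prod_type, show (Finset.univ : Finset (ZMod 2)) = {0, 1} from rfl,
        Finset.sum_pair zero_ne_one]
      refine congrArg₂ (· + ·) (Finset.sum_congr rfl fun y _ => if_congr ?_ rfl rfl)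
        (Finset.sum_congr rfl fun y _ => if_congr ?_ rfl rfl)
      · change hammingNorm (Fin.cons 0 y : Fin (rs.length + 1) → ZMod 2) = k ∧
          P ((Fin.cons 0 y : Fin (rs.length + 1) → ZMod 2) ᵥ* bitMatrix m (r :: rs)) ↔ _
        rw [hx, hammingNorm_cons]
        simp
      · change hammingNorm (Fin.cons 1 y : Fin (rs.length + 1) → ZMod 2) = k ∧
          P ((Fin.cons 1 y : Fin (rs.length + 1) → ZMod 2) ᵥ* bitMatrix m (r :: rs)) ↔ _
        rw [hx, hammingNorm_cons]
        simp [add_comm]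
    refine hsum.trans ?_
    rw [ih k P]
    cases k with
    | zero => simp [subsetSums]
    | succ k =>
      simp only [add_left_inj, ih k fun v => P (bitVec m r + v)]
      simp [subsetSums, List.countP_map, bitVec_xor, Function.comp_def]

theorem splitCount_bitMatrix {rs : List ℕ} (h : ∀ r ∈ rs, r < 2 ^ 32) (hlen : rs.length ≤ 31)
    {K k t : ℕ} (hk : k < K) (ht : t < 32) :
    splitCount (bitMatrix 28 rs) k t = countEq ((packedWords K rs).getD k (0, 0)) t := by
  have hl : (subsetSums rs k).length < 2 ^ 32 - 1 := by
    rw [length_subsetSums]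
    exact (Nat.choose_le_two_pow _ _).trans_lt
      ((Nat.pow_le_pow_right two_pos hlen).trans_lt (by norm_num))
  rw [splitCount, card_weight_eq_countP 28 rs k fun v => hammingNorm v = t, packedWords_eq K h,
    List.getD_eq_getElem _ _ (by simpa using hk), List.getElem_map, List.getElem_range,
    countEq_ofDigits (subsetSums_lt h k) ht hl]
  simp only [hammingNorm_bitVec]

/-- The rows of the check block of a code with an automorphism of order 13. -/
def checkRows : List ℕ :=
  [223969969, 229836130, 93977284, 164371063, 90692369, 30386653, 224443461, 163669877,
   24985322, 100295211, 218838102, 219572396, 153931431, 237154662, 239428300, 243975576,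
   116030256, 170596767, 240528577, 179062397, 44530938, 246486539, 111008790, 180639699,
   41377702, 116302003, 67112959, 150990848]

/-- The columns of the same block. -/
def checkCols : List ℕ :=
  [112071417, 133314314, 88767724, 70961952, 115049657, 119094155, 77358574, 127326501,
   92512434, 94983069, 100439490, 89594236, 166929756, 169177060, 165272212, 172011637,
   158483895, 186101298, 198990136, 172726061, 157551367, 188429138, 193283065, 184124078, 8191,
   67100672, 107343447, 145685707]

/-- A matrix `A` for which `[I | A]` generates a self-dual code. -/
def checkBlock : Matrix (Fin 28) (Fin 28) (ZMod 2) := bitMatrix 28 checkRows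

theorem checkBlock_transpose : checkBlockᵀ =
    (bitMatrix 28 checkCols : Matrix (Fin checkCols.length) _ _) := by
  refine Matrix.ext ?_
  change ∀ i j : Fin 28, bitVec 28 (checkRows[j]'j.2) i = bitVec 28 (checkCols[i]'i.2) j
  decide +kernel

theorem checkBlock_mul_transpose : checkBlock * checkBlockᵀ = 1 := by
  refine Matrix.ext ?_
  change ∀ i j : Fin 28,
      ∑ k : Fin 28, bitVec 28 (checkRows[i]'i.2) k * bitVec 28 (checkRows[j]'j.2) k =
      if i = j then 1 else 0
  decide +kernel

theorem splitCount_checkBlock {k t : ℕ} (hk : k < 7) (ht : t < 32) :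
    splitCount checkBlock k t = countEq ((packedWords 7 checkRows).getD k (0, 0)) t :=
  splitCount_bitMatrix (rs := checkRows) (by decide) (by decide) hk ht

theorem splitCount_checkBlock_of_lt {k t : ℕ} (hk : k < 32) (ht : t < 7) :
    splitCount checkBlock k t = countEq ((packedWords 7 checkCols).getD t (0, 0)) k := by
  rw [← splitCount_transpose checkBlock_mul_transpose, checkBlock_transpose]
  exact splitCount_bitMatrix (rs := checkCols) (by decide) (by decide) ht hk

theorem ncard_checkBlock {w : ℕ} (hw : w < 13) :
    {v : Fin 56 → ZMod 2 | v ∈ systematicCode checkBlock ∧ hammingNorm v = w}.ncard =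
      weightCount (packedWords 7 checkRows) (packedWords 7 checkCols) w := by
  refine (ncard_systematicCode checkBlock w).trans ?_
  rw [weightCount, ← List.sum_toFinset _ List.nodup_range, List.toFinset_range]
  refine Finset.sum_congr rfl fun k hk => ?_
  have := Finset.mem_range.1 hk
  split_ifs
  · exact splitCount_checkBlock (by omega) (by omega)
  · exact splitCount_checkBlock_of_lt (by omega) (by omega)

theorem weightCount_values :
    (List.range 13).map (weightCount (packedWords 7 checkRows) (packedWords 7 checkCols)) =
      [1, 0, 0, 0, 0, 0, 0, 0, 0, 0, 260, 0, 4342] := by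
  decide +kernel

theorem ncard_checkBlock_values {w : ℕ} (hw : w < 13) :
    {v : Fin 56 → ZMod 2 | v ∈ systematicCode checkBlock ∧ hammingNorm v = w}.ncard =
      [1, 0, 0, 0, 0, 0, 0, 0, 0, 0, 260, 0, 4342].getD w 0 := by
  rw [ncard_checkBlock hw, ← weightCount_values, List.getD_eq_getElem _ _ (by simpa using hw),
    List.getElem_map, List.getElem_range]

theorem stmt13 : ∃ C : Submodule (ZMod 2) (Fin 56 → ZMod 2),
    C = dualCode C ∧
    Module.finrank (ZMod 2) C = 28 ∧
    (∀ v ∈ C, v ≠ 0 → 10 ≤ hammingNorm v) ∧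
    (∃ v ∈ C, hammingNorm v = 10) ∧
    {v : Fin 56 → ZMod 2 | v ∈ C ∧ hammingNorm v = 10}.ncard = 260 ∧
    {v : Fin 56 → ZMod 2 | v ∈ C ∧ hammingNorm v = 12}.ncard = 4342 := by
  have h10 := ncard_checkBlock_values (w := 10) (by norm_num)
  refine ⟨systematicCode checkBlock, dualCode_systematicCode checkBlock_mul_transpose,
    finrank_systematicCode checkBlock, fun v hv hv0 => ?_,
    Set.nonempty_of_ncard_ne_zero (h10.trans_ne (by decide)), h10,
    ncard_checkBlock_values (by norm_num)⟩
  by_contra! hlt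
  have hpos : hammingNorm v ≠ 0 := hammingNorm_ne_zero_iff.2 hv0
  have h0 : [1, 0, 0, 0, 0, 0, 0, 0, 0, 0, 260, 0, 4342].getD (hammingNorm v) 0 = 0 := by
    generalize hammingNorm v = w at hlt hpos
    interval_cases w <;> first | rfl | contradiction
  have h := (ncard_checkBlock_values (hlt.trans (by norm_num))).trans h0
  rw [Set.ncard_eq_zero (Set.toFinite _)] at h
  exact Set.eq_empty_iff_forall_notMem.1 h v ⟨hv, rfl⟩
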